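/- For every real x with 0 < x < 1, one has e^{π²/(6·log x)} < R₀(1,x) < ∏_{n=1}^∞ (1 - x^n) ≤ C·R₀(1,x), where R₀(1,x) = e^{π²/(6·log x)}·(1 + 4π²/(log x)²)^{1/4} and C = e^{π/12}·2^{-1/4}·∏_{n=1}^∞ (1 - e^{-2πn}). -/

import Mathlib

/-- The Euler product `∏ (1 - q ^ n)` over `n ≥ 1`, for real `q`. -/
noncomputable def eulerProd (q : ℝ) : ℝ := ∏' n : ℕ, (1 - q ^ (n + 1))

/-- The logarithm of `∏ (1 - x ^ n) / R₀(1, x)` at `x = exp (-2π / u)`. -/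
noncomputable def logRatio (u : ℝ) : ℝ :=
  Real.pi * u / 12 - Real.log (1 + u ^ 2) / 4 +
    Real.log (eulerProd (Real.exp (-(2 * Real.pi / u))))

section EulerProduct

variable {q : ℝ}

lemma one_sub_pow_succ_pos (h0 : 0 ≤ q) (h1 : q < 1) (n : ℕ) : 0 < 1 - q ^ (n + 1) :=
  sub_pos.2 (pow_lt_one₀ h0 h1 n.succ_ne_zero)

lemma summable_log_one_sub_pow_succ (h0 : 0 ≤ q) (h1 : q < 1) :
    Summable fun n : ℕ ↦ Real.log (1 - q ^ (n + 1)) := by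
  have h : Summable fun n : ℕ ↦ -q ^ (n + 1) :=
    ((summable_nat_add_iff 1).2 (summable_geometric_of_lt_one h0 h1)).neg
  simpa [sub_eq_add_neg] using Real.summable_log_one_add_of_summable h

lemma eulerProd_eq_exp (h0 : 0 ≤ q) (h1 : q < 1) :
    eulerProd q = Real.exp (∑' n : ℕ, Real.log (1 - q ^ (n + 1))) :=
  (Real.rexp_tsum_eq_tprod (one_sub_pow_succ_pos h0 h1)
    (summable_log_one_sub_pow_succ h0 h1)).symm

lemma eulerProd_pos (h0 : 0 ≤ q) (h1 : q < 1) : 0 < eulerProd q := by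
  rw [eulerProd_eq_exp h0 h1]
  exact Real.exp_pos _

lemma hasSum_log_eulerProd (h0 : 0 ≤ q) (h1 : q < 1) :
    HasSum (fun n : ℕ ↦ Real.log (1 - q ^ (n + 1))) (Real.log (eulerProd q)) := by
  rw [eulerProd_eq_exp h0 h1, Real.log_exp]
  exact (summable_log_one_sub_pow_succ h0 h1).hasSum

lemma ofReal_eulerProd (h0 : 0 ≤ q) (h1 : q < 1) :
    (eulerProd q : ℂ) = ∏' n : ℕ, (1 - (q : ℂ) ^ (n + 1)) := by
  have h : Multipliable fun n : ℕ ↦ 1 - q ^ (n + 1) :=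
    Real.multipliable_of_summable_log (one_sub_pow_succ_pos h0 h1)
      (summable_log_one_sub_pow_succ h0 h1)
  simpa [eulerProd] using h.map_tprod (G := ℝ →+* ℂ) Complex.ofRealHom Complex.continuous_ofReal

lemma differentiableAt_eulerProd (h0 : 0 < q) (h1 : q < 1) :
    DifferentiableAt ℝ eulerProd q := by
  have hq : (q : ℂ) ∈ Metric.ball (0 : ℂ) 1 := by
    simpa [abs_of_pos h0] using h1
  have h := (ModularForm.differentiableOn_tprod_one_sub_pow.differentiableAt
    (Metric.isOpen_ball.mem_nhds hq)).hasDerivAt.real_of_complex.differentiableAt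
  refine h.congr_of_eventuallyEq ?_
  filter_upwards [Ioo_mem_nhds h0 h1] with y hy
  rw [← ofReal_eulerProd hy.1.le hy.2, Complex.ofReal_re]

lemma neg_div_le_log_eulerProd (h0 : 0 ≤ q) (h1 : q < 1) :
    -(q / (1 - q) ^ 2) ≤ Real.log (eulerProd q) := by
  have hq : 0 < 1 - q := sub_pos.2 h1
  have hs : HasSum (fun n : ℕ ↦ -(q / (1 - q)) * q ^ n) (-(q / (1 - q)) * (1 - q)⁻¹) :=
    (hasSum_geometric_of_lt_one h0 h1).mul_left _
  have he : -(q / (1 - q) ^ 2) = -(q / (1 - q)) * (1 - q)⁻¹ := by field_simp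
  rw [he]
  refine hasSum_le (fun n ↦ ?_) hs (hasSum_log_eulerProd h0 h1)
  have hp := one_sub_pow_succ_pos h0 h1 n
  have hle : q ^ (n + 1) ≤ q := pow_le_of_le_one h0 h1.le n.succ_ne_zero
  calc -(q / (1 - q)) * q ^ n = -(q ^ (n + 1) / (1 - q)) := by ring
    _ ≤ -(q ^ (n + 1) / (1 - q ^ (n + 1))) := by gcongr
    _ = 1 - (1 - q ^ (n + 1))⁻¹ := by field_simp; ring
    _ ≤ _ := Real.one_sub_inv_le_log_of_pos hp

end EulerProduct

lemma exp_neg_two_pi_div_lt_one {u : ℝ} (hu : 0 < u) : Real.exp (-(2 * Real.pi / u)) < 1 :=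
  Real.exp_lt_one_iff.2 (neg_lt_zero.2 (by positivity))

open Complex in
/-- The transformation of the Dedekind eta function under `t ↦ 1 / t` on the imaginary axis,
raised to the 24th power. -/
lemma exp_mul_eulerProd_pow_inv {t : ℝ} (ht : 0 < t) :
    Real.exp (-(2 * Real.pi / t)) * eulerProd (Real.exp (-(2 * Real.pi / t))) ^ 24 =
      t ^ 12 * (Real.exp (-(2 * Real.pi * t)) *
        eulerProd (Real.exp (-(2 * Real.pi * t))) ^ 24) := by
  have key (s : ℝ) (hs : 0 < s) : ModularForm.eta (I * s) ^ 24 =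
      ((Real.exp (-(2 * Real.pi * s)) *
        eulerProd (Real.exp (-(2 * Real.pi * s))) ^ 24 : ℝ) : ℂ) := by
    have hq : cexp (2 * Real.pi * I * (I * s)) = (Real.exp (-(2 * Real.pi * s)) : ℝ) := by
      rw [Complex.ofReal_exp]
      congr 1
      push_cast
      linear_combination (2 * Real.pi * s : ℂ) * I_sq
    have h1 : Real.exp (-(2 * Real.pi * s)) < 1 :=
      Real.exp_lt_one_iff.2 (neg_lt_zero.2 (by positivity))
    have hpref : Function.Periodic.qParam 24 (I * s) ^ 24 =
        (Real.exp (-(2 * Real.pi * s)) : ℝ) := by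
      rw [← hq, Function.Periodic.qParam, ← Complex.exp_nat_mul]
      push_cast
      ring_nf
    have hprod : ∏' n, (1 - ModularForm.eta_q n (I * s)) =
        (eulerProd (Real.exp (-(2 * Real.pi * s))) : ℝ) := by
      rw [ofReal_eulerProd (Real.exp_pos _).le h1]
      simp_rw [ModularForm.eta_q_eq_pow, hq]
    rw [ModularForm.eta, mul_pow, hpref, hprod, Complex.ofReal_mul, Complex.ofReal_pow]
  have hsqrt (z : ℂ) (hz : z ≠ 0) : sqrt z ^ 24 = z ^ 12 := by
    rw [sqrt_eq_exp hz, ← Complex.exp_nat_mul,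
      show ((24 : ℕ) : ℂ) * (log z / 2) = (12 : ℕ) * log z by push_cast; ring,
      Complex.exp_nat_mul, exp_log hz]
  have ht' : (t : ℂ) ≠ 0 := by exact_mod_cast ht.ne'
  have hmem : I * t ∈ UpperHalfPlane.upperHalfPlaneSet := by
    simpa [UpperHalfPlane.upperHalfPlaneSet] using ht
  have hinv : -1 / (I * t) = I * ((t⁻¹ : ℝ) : ℂ) := by
    push_cast
    field_simp
    simp
  have hS := congrArg (· ^ 24) (ModularForm.eta_comp_eq_csqrt_I_inv hmem)
  simp only [Function.comp_apply, Pi.smul_apply, Pi.mul_apply, smul_eq_mul, hinv, mul_pow,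
    inv_pow, hsqrt _ I_ne_zero, hsqrt _ (mul_ne_zero I_ne_zero ht')] at hS
  rw [key _ (inv_pos.2 ht), key _ ht, mul_assoc (I ^ 12), inv_mul_cancel_left₀
    (pow_ne_zero _ I_ne_zero), ← div_eq_mul_inv] at hS
  exact_mod_cast hS

lemma logRatio_inv {u : ℝ} (hu : 0 < u) : logRatio u⁻¹ = logRatio u := by
  have h1 := exp_neg_two_pi_div_lt_one hu
  have h2 := exp_neg_two_pi_div_lt_one (inv_pos.2 hu)
  rw [div_inv_eq_mul] at h2
  have hp1 := eulerProd_pos (Real.exp_pos _).le h1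
  have hp2 := eulerProd_pos (Real.exp_pos _).le h2
  have h := congrArg Real.log (exp_mul_eulerProd_pow_inv hu)
  rw [Real.log_mul (Real.exp_pos _).ne' (pow_pos hp1 _).ne', Real.log_mul (by positivity)
    (mul_pos (Real.exp_pos _) (pow_pos hp2 _)).ne',
    Real.log_mul (Real.exp_pos _).ne' (pow_pos hp2 _).ne', Real.log_exp, Real.log_exp,
    Real.log_pow, Real.log_pow, Real.log_pow] at h
  have hlog : Real.log (1 + u⁻¹ ^ 2) = Real.log (1 + u ^ 2) - 2 * Real.log u := by
    rw [show 1 + u⁻¹ ^ 2 = (1 + u ^ 2) / u ^ 2 by field_simp; ring,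
      Real.log_div (by positivity) (by positivity), Real.log_pow]
    norm_num
  have hdiv : 2 * Real.pi / u = 2 * (Real.pi * u⁻¹) := by ring
  simp only [logRatio, div_inv_eq_mul, hlog]
  rw [hdiv] at h ⊢
  push_cast at h
  linarith

lemma sq_mul_exp_sub_one_le {v w : ℝ} (hv : 2 ≤ v) (hvw : v ≤ w) :
    w ^ 2 * (Real.exp v - 1) ≤ v ^ 2 * (Real.exp w - 1) := by
  have hd : 0 ≤ w - v := sub_nonneg.2 hvw
  have hq := Real.quadratic_le_exp_of_nonneg hd
  have hexp : Real.exp w = Real.exp v * Real.exp (w - v) := by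
    rw [← Real.exp_add]
    ring_nf
  have hsq : w ^ 2 ≤ v ^ 2 * Real.exp (w - v) := by
    calc w ^ 2 ≤ v ^ 2 * (1 + (w - v) + (w - v) ^ 2 / 2) := by
          nlinarith [mul_nonneg hd (mul_nonneg (show 0 ≤ v by linarith) (sub_nonneg.2 hv)),
            mul_nonneg (sq_nonneg (w - v)) (show 0 ≤ v ^ 2 - 2 by nlinarith)]
      _ ≤ _ := by gcongr
  have h2 : v ^ 2 ≤ w ^ 2 := by gcongr
  rw [hexp]
  nlinarith [mul_le_mul_of_nonneg_left hsq (Real.exp_pos v).le]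

lemma concaveOn_log_one_sub_exp_neg_div {a : ℝ} (ha : 2 ≤ a) :
    ConcaveOn ℝ (Set.Ioc 0 1) fun u ↦ Real.log (1 - Real.exp (-(a / u))) := by
  have hderiv (u : ℝ) (hu : 0 < u) : HasDerivAt (fun u ↦ Real.log (1 - Real.exp (-(a / u))))
      (-(a / (u ^ 2 * (Real.exp (a / u) - 1)))) u := by
    have hau : 0 < a / u := by positivity
    have hlt : 1 < Real.exp (a / u) := Real.one_lt_exp_iff.2 hau
    have hne : 1 - Real.exp (-(a / u)) ≠ 0 := by
      rw [Real.exp_neg]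
      exact (sub_pos.2 (inv_lt_one_of_one_lt₀ hlt)).ne'
    convert! ((((hasDerivAt_inv hu.ne').const_mul a).neg.exp).const_sub 1).log
      (by simpa [div_eq_mul_inv] using hne) using 1
    have h1 : Real.exp (a / u) - 1 ≠ 0 := (sub_pos.2 hlt).ne'
    simp only [Pi.neg_apply, ← div_eq_mul_inv, Real.exp_neg]
    field_simp
  refine AntitoneOn.concaveOn_of_deriv (convex_Ioc 0 1)
    (fun u hu ↦ (hderiv u hu.1).continuousAt.continuousWithinAt) ?_ ?_
  · rw [interior_Ioc]
    exact fun u hu ↦ (hderiv u hu.1).differentiableAt.differentiableWithinAt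
  · rw [interior_Ioc]
    intro u hu w hw huw
    have hu0 := hu.1
    have hw0 := hw.1
    rw [(hderiv u hu0).deriv, (hderiv w hw0).deriv, neg_le_neg_iff]
    have hpos : 0 < Real.exp (a / w) - 1 :=
      sub_pos.2 (Real.one_lt_exp_iff.2 (by positivity))
    have hle := sq_mul_exp_sub_one_le (v := a / w) (w := a / u)
      ((le_div_iff₀ hw0).2 (by nlinarith [hw.2])) (by gcongr)
    have : w ^ 2 * (Real.exp (a / w) - 1) ≤ u ^ 2 * (Real.exp (a / u) - 1) := by
      rw [div_pow, div_pow, div_mul_eq_mul_div, div_mul_eq_mul_div,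
        div_le_div_iff₀ (by positivity) (by positivity)] at hle
      have ha2 : 0 < a ^ 2 := by positivity
      refine le_of_mul_le_mul_left ?_ ha2
      linarith
    gcongr

lemma concaveOn_log_eulerProd_exp_neg_div :
    ConcaveOn ℝ (Set.Ioc 0 1) fun u ↦
      Real.log (eulerProd (Real.exp (-(2 * Real.pi / u)))) := by
  have hs (u : ℝ) (hu : u ∈ Set.Ioc (0 : ℝ) 1) := hasSum_log_eulerProd (Real.exp_pos _).le
    (exp_neg_two_pi_div_lt_one hu.1)
  have hpow (u : ℝ) (n : ℕ) : Real.exp (-(2 * Real.pi / u)) ^ (n + 1) =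
      Real.exp (-(2 * Real.pi * (n + 1) / u)) := by
    rw [← Real.exp_nat_mul]
    push_cast
    ring_nf
  simp_rw [hpow] at hs
  refine ⟨convex_Ioc 0 1, fun x hx y hy a b ha hb hab ↦ ?_⟩
  refine hasSum_le (fun n ↦ ?_) (((hs x hx).const_smul a).add ((hs y hy).const_smul b))
    (hs _ (convex_Ioc 0 1 hx hy ha hb hab))
  refine (concaveOn_log_one_sub_exp_neg_div ?_).2 hx hy ha hb hab
  nlinarith [Real.pi_gt_three, (Nat.cast_nonneg n : (0 : ℝ) ≤ n)]

lemma concaveOn_neg_log_one_add_sq :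
    ConcaveOn ℝ (Set.Ioc 0 1) fun u : ℝ ↦ -(Real.log (1 + u ^ 2) / 4) := by
  have hderiv (u : ℝ) : HasDerivAt (fun u : ℝ ↦ -(Real.log (1 + u ^ 2) / 4))
      (-(u / (1 + u ^ 2) / 2)) u := by
    convert! ((((hasDerivAt_pow 2 u).const_add 1).log (by positivity)).div_const 4).neg using 1
    ring
  refine AntitoneOn.concaveOn_of_deriv (convex_Ioc 0 1)
    (fun u _ ↦ (hderiv u).continuousAt.continuousWithinAt)
    (fun u _ ↦ (hderiv u).differentiableAt.differentiableWithinAt) ?_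
  rw [interior_Ioc]
  intro u hu w hw huw
  rw [(hderiv u).deriv, (hderiv w).deriv, neg_le_neg_iff]
  refine div_le_div_of_nonneg_right ?_ zero_le_two
  rw [div_le_div_iff₀ (by positivity) (by positivity)]
  nlinarith [mul_nonneg (sub_nonneg.2 huw) (sub_nonneg.2 (mul_le_one₀ hu.2.le hw.1.le hw.2.le))]

lemma concaveOn_logRatio : ConcaveOn ℝ (Set.Ioc 0 1) logRatio := by
  have hlin : ConcaveOn ℝ (Set.Ioc 0 1) fun u : ℝ ↦ Real.pi * u / 12 :=
    ⟨convex_Ioc 0 1, fun x _ y _ a b _ _ _ ↦ by simp only [smul_eq_mul]; linarith⟩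
  refine ((hlin.add concaveOn_neg_log_one_add_sq).add
    concaveOn_log_eulerProd_exp_neg_div).congr fun u _ ↦ ?_
  simp only [logRatio, Pi.add_apply]
  ring

lemma differentiableAt_logRatio {u : ℝ} (hu : 0 < u) : DifferentiableAt ℝ logRatio u := by
  have h1 := exp_neg_two_pi_div_lt_one hu
  have he : DifferentiableAt ℝ (fun u ↦ eulerProd (Real.exp (-(2 * Real.pi / u)))) u :=
    (differentiableAt_eulerProd (Real.exp_pos _) h1).comp u
      (f := fun u ↦ Real.exp (-(2 * Real.pi / u))) (by fun_prop (disch := exact hu.ne'))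
  have hl := he.log (eulerProd_pos (Real.exp_pos _).le h1).ne'
  have hs : DifferentiableAt ℝ (fun u : ℝ ↦ Real.log (1 + u ^ 2)) u :=
    DifferentiableAt.log (by fun_prop) (by positivity)
  unfold logRatio
  fun_prop

lemma hasDerivAt_logRatio_one : HasDerivAt logRatio 0 1 := by
  have h := (differentiableAt_logRatio one_pos).hasDerivAt
  have h2 : HasDerivAt logRatio (deriv logRatio 1 * -1) 1 := by
    have hi : HasDerivAt (fun u : ℝ ↦ u⁻¹) (-1) 1 := by
      simpa using hasDerivAt_inv (one_ne_zero (α := ℝ))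
    have h' : HasDerivAt logRatio (deriv logRatio 1) (1 : ℝ)⁻¹ := by rwa [inv_one]
    refine (h'.comp (1 : ℝ) hi).congr_of_eventuallyEq ?_
    filter_upwards [Ioi_mem_nhds (one_pos (α := ℝ))] with u hu
    exact (logRatio_inv hu).symm
  have := h.unique h2
  rwa [show deriv logRatio 1 = 0 by linarith] at h

lemma logRatio_le_one {u : ℝ} (hu : 0 < u) : logRatio u ≤ logRatio 1 := by
  have small {v : ℝ} (hv : 0 < v) (hv1 : v ≤ 1) : logRatio v ≤ logRatio 1 := by
    rcases hv1.eq_or_lt with rfl | hlt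
    · rfl
    have h := concaveOn_logRatio.le_slope_of_hasDerivAt ⟨hv, hv1⟩ ⟨one_pos, le_rfl⟩ hlt
      hasDerivAt_logRatio_one
    rw [slope_def_field] at h
    have h' := mul_nonneg h (sub_pos.2 hlt).le
    rw [div_mul_cancel₀ _ (sub_pos.2 hlt).ne'] at h'
    linarith
  rcases le_total u 1 with h | h
  · exact small hu h
  · rw [← logRatio_inv hu]
    exact small (inv_pos.2 hu) (inv_le_one_of_one_le₀ h)

lemma logRatio_pos {u : ℝ} (hu : 0 < u) : 0 < logRatio u := by
  have small {u : ℝ} (hu : 0 < u) (hu1 : u ≤ 1) : 0 < logRatio u := by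
    have hlog : Real.log (1 + u ^ 2) ≤ u := by
      rw [Real.log_le_iff_le_exp (by positivity)]
      nlinarith [Real.quadratic_le_exp_of_nonneg hu.le]
    have hpi := Real.pi_gt_d2
    have hprod := neg_div_le_log_eulerProd (Real.exp_pos _).le (exp_neg_two_pi_div_lt_one hu)
    set v := 2 * Real.pi / u with hv
    have huv : u * v = 2 * Real.pi := by
      rw [hv]
      field_simp
    have hv6 : 6.28 ≤ v := by
      rw [hv, le_div_iff₀ hu]
      nlinarith
    have hexp : v ^ 3 / 6 + v ^ 4 / 24 ≤ Real.exp v := by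
      have h := Real.sum_le_exp_of_nonneg (show 0 ≤ v by linarith) 5
      simp only [Finset.sum_range_succ, Finset.sum_range_zero, Nat.factorial] at h
      norm_num at h
      nlinarith [sq_nonneg v]
    have hlarge : 14 * v + 2 < Real.exp v := by
      refine lt_of_lt_of_le ?_ hexp
      have h2 : 6.28 ^ 2 ≤ v ^ 2 := by gcongr
      have h3 : 39 * v ≤ v ^ 3 := by nlinarith
      have h4 : 240 * v ≤ v ^ 4 := by nlinarith
      linarith
    have hq : Real.exp (-v) / (1 - Real.exp (-v)) ^ 2 < u * (Real.pi / 12 - 1 / 4) := by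
      have hE : 0 < Real.exp v - 2 := by linarith
      calc Real.exp (-v) / (1 - Real.exp (-v)) ^ 2
          = Real.exp v / (Real.exp v - 1) ^ 2 := by
            have : Real.exp v - 1 ≠ 0 := by linarith
            rw [Real.exp_neg]
            field_simp
        _ ≤ 1 / (Real.exp v - 2) := by
            rw [div_le_div_iff₀ (by nlinarith) hE]
            nlinarith
        _ < 1 / (14 * v) := by
            gcongr
            linarith
        _ ≤ u * (Real.pi / 12 - 1 / 4) := by
            rw [div_le_iff₀ (by positivity)]
            nlinarith
    rw [logRatio]
    linarith
  rcases le_total u 1 with h | h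
  · exact small hu h
  · rw [← logRatio_inv hu]
    exact small (inv_pos.2 hu) (inv_le_one_of_one_le₀ h)

/-- Corollary 2.4: For real `0 < x < 1`, with
`R₀(1,x) = e^{π²/(6 log x)} (1 + 4π²/(log x)²)^{1/4}` and
`C = e^{π/12} 2^{-1/4} ∏_{n=1}^∞ (1 - e^{-2πn})`, one has
`e^{π²/(6 log x)} < R₀(1,x) < ∏_{n=1}^∞ (1 - x^n) ≤ C R₀(1,x)`. -/
theorem stmt8 (x : ℝ) (hx0 : 0 < x) (hx1 : x < 1) :
    let R0 : ℝ := Real.exp (Real.pi ^ 2 / (6 * Real.log x)) *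
      (1 + 4 * Real.pi ^ 2 / (Real.log x) ^ 2) ^ ((1 : ℝ) / 4)
    let C : ℝ := Real.exp (Real.pi / 12) * (2 : ℝ) ^ (-(1 : ℝ) / 4) *
      ∏' n : ℕ, (1 - Real.exp (-2 * Real.pi * ((n : ℝ) + 1)))
    Real.exp (Real.pi ^ 2 / (6 * Real.log x)) < R0 ∧
    R0 < (∏' n : ℕ, (1 - x ^ (n + 1))) ∧
    (∏' n : ℕ, (1 - x ^ (n + 1))) ≤ C * R0 := by
  intro R0 C
  have hlog : Real.log x < 0 := Real.log_neg hx0 hx1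
  obtain ⟨u, hu⟩ : ∃ u, u = -(2 * Real.pi / Real.log x) := ⟨_, rfl⟩
  have hu0 : 0 < u := by
    rw [hu, neg_pos]
    exact div_neg_of_pos_of_neg (by positivity) hlog
  have hx : x = Real.exp (-(2 * Real.pi / u)) := by
    rw [hu, div_neg, neg_neg, div_div_cancel₀ (by positivity), Real.exp_log hx0]
  have hexp : Real.pi ^ 2 / (6 * Real.log x) = -(Real.pi * u / 12) := by
    rw [hu]
    field_simp
    norm_num
  have hsq : 4 * Real.pi ^ 2 / Real.log x ^ 2 = u ^ 2 := by
    rw [hu]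
    ring
  have hR0 : R0 = Real.exp (-(Real.pi * u / 12) + Real.log (1 + u ^ 2) / 4) := by
    simp only [R0]
    rw [hexp, hsq, Real.rpow_def_of_pos (by positivity), ← Real.exp_add]
    ring_nf
  have hP : ∏' n : ℕ, (1 - x ^ (n + 1)) = Real.exp (logRatio u) * R0 := by
    have h := eulerProd_pos hx0.le hx1
    change eulerProd x = _
    rw [hR0, ← Real.exp_add, logRatio, ← hx]
    ring_nf
    exact (Real.exp_log h).symm
  have hC : C = Real.exp (logRatio 1) := by
    have h1 := exp_neg_two_pi_div_lt_one one_pos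
    have h := eulerProd_pos (Real.exp_pos _).le h1
    have hprod : ∏' n : ℕ, (1 - Real.exp (-2 * Real.pi * ((n : ℝ) + 1))) =
        eulerProd (Real.exp (-(2 * Real.pi / 1))) := by
      refine tprod_congr fun n ↦ ?_
      rw [← Real.exp_nat_mul]
      push_cast
      ring_nf
    simp only [C]
    rw [hprod, logRatio, Real.exp_add, Real.exp_log h, sub_eq_add_neg, Real.exp_add,
      Real.rpow_def_of_pos two_pos]
    congr 3 <;> ring_nf
  have hR0_pos : 0 < R0 := hR0 ▸ Real.exp_pos _
  refine ⟨?_, ?_, ?_⟩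
  · rw [hexp, hR0, Real.exp_lt_exp]
    have : 0 < Real.log (1 + u ^ 2) := Real.log_pos (lt_add_of_pos_right _ (by positivity))
    linarith
  · rw [hP]
    exact lt_mul_of_one_lt_left hR0_pos (Real.one_lt_exp_iff.2 (logRatio_pos hu0))
  · rw [hP, hC]
    gcongr
    exact logRatio_le_one hu0
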